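/- arXiv:0801.3314 — 2 statements merged into one kernel-verified Lean document; each statement's English description precedes it below -/
import Mathlib

section
/- Let H ∈ (0,1) and K ∈ (0,1]. For all real numbers 0 ≤ s ≤ t one has 2^{-K} (t - s)^{2HK} ≤ t^{2HK} + s^{2HK} - 2^{1-K}((t^{2H} + s^{2H})^K - (t - s)^{2HK}) ≤ 2^{1-K} (t - s)^{2HK}. (The middle expression equals R(t,t) + R(s,s) - 2R(t,s), i.e. the variance E|B^{H,K}_t - B^{H,K}_s|^2 of an increment of the bifractional Brownian motion.) -/
/-- Weighted AM-GM in the form of a rational lower bound for `x ^ K`. -/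
lemma div_le_rpow_of_mem_Ioc {K x : ℝ} (hK : K ∈ Set.Ioc (0 : ℝ) 1) (hx : 0 ≤ x) :
    x / (K + (1 - K) * x) ≤ x ^ K := by
  obtain ⟨hK0, hK1⟩ := hK
  have hd : 0 < K + (1 - K) * x := by nlinarith [mul_nonneg (sub_nonneg.2 hK1) hx]
  rcases hx.eq_or_lt with rfl | hx
  · simp [Real.zero_rpow hK0.ne']
  · have h := Real.geom_mean_le_arith_mean2_weighted hK0.le (sub_nonneg.2 hK1)
      zero_le_one hx.le (by ring)
    rw [Real.one_rpow, one_mul, mul_one] at h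
    have h2 : x ^ K * x ^ (1 - K) = x := by
      rw [← Real.rpow_add hx]; simp
    rw [div_le_iff₀ hd]
    calc x = x ^ K * x ^ (1 - K) := h2.symm
      _ ≤ _ := mul_le_mul_of_nonneg_left h (Real.rpow_nonneg hx.le _)

lemma two_le_one_add_rpow_add_one_sub_rpow_add_rpow {K B c : ℝ} (hK : K ∈ Set.Ioc (0 : ℝ) 1)
    (hB0 : 0 ≤ B) (hB1 : B ≤ 1) (hc0 : 0 ≤ c) (hc1 : c ≤ 1) (hBc : B ^ 2 = c * (2 - c)) :
    2 ≤ (1 + B) ^ K + (1 - B) ^ K + c ^ K := by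
  have h1 := div_le_rpow_of_mem_Ioc hK (show 0 ≤ 1 + B by linarith)
  have h2 := div_le_rpow_of_mem_Ioc hK (show 0 ≤ 1 - B by linarith)
  have h3 := div_le_rpow_of_mem_Ioc hK hc0
  obtain ⟨hK0, hK1⟩ := hK
  have e1 : 0 < K + (1 - K) * (1 + B) := by nlinarith
  have e2 : 0 < K + (1 - K) * (1 - B) := by nlinarith
  have e3 : 0 < K + (1 - K) * c := by nlinarith
  have key : 2 * (1 - K) * K * (2 - c) * (K + (1 - K) * c) ≤ 1 - (1 - K) ^ 2 * B ^ 2 := by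
    rw [hBc]
    obtain ⟨e, rfl⟩ : ∃ e, c = 1 - e := ⟨1 - c, by ring⟩
    obtain ⟨a, rfl⟩ : ∃ a, K = 1 - a := ⟨1 - K, by ring⟩
    have : 0 ≤ (1 - a) ^ 2 - 2 * a * (1 - a) ^ 2 * e + (a ^ 2 + 2 * a ^ 2 * (1 - a)) * e ^ 2 := by
      have ha : 0 ≤ a := by linarith
      nlinarith [sq_nonneg ((1 - a) - a * (1 - a) * e), mul_nonneg (sq_nonneg (a * e)) ha,
        mul_nonneg (sq_nonneg (a * e)) hK0.le,
        mul_nonneg (sq_nonneg (a * e)) (mul_nonneg ha hK0.le)]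
    nlinarith
  have hsum : 2 - ((1 + B) / (K + (1 - K) * (1 + B)) + (1 - B) / (K + (1 - K) * (1 - B)))
      = 2 * (1 - K) * K * B ^ 2 / (1 - (1 - K) ^ 2 * B ^ 2) := by
    have : 1 - (1 - K) ^ 2 * B ^ 2 = (K + (1 - K) * (1 + B)) * (K + (1 - K) * (1 - B)) := by ring
    rw [this]
    field_simp
    ring
  have hpos : 0 < 1 - (1 - K) ^ 2 * B ^ 2 := by nlinarith [mul_pos e1 e2]
  have hle : 2 * (1 - K) * K * B ^ 2 / (1 - (1 - K) ^ 2 * B ^ 2) ≤ c / (K + (1 - K) * c) := by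
    rw [div_le_div_iff₀ hpos e3]
    calc _ = c * (2 * (1 - K) * K * (2 - c) * (K + (1 - K) * c)) := by rw [hBc]; ring
      _ ≤ _ := mul_le_mul_of_nonneg_left key hc0
  linarith

lemma two_mul_sq_add_sq_rpow_le {K p q : ℝ} (hK : K ∈ Set.Ioc (0 : ℝ) 1)
    (hq : 0 ≤ q) (hqp : q ≤ p) :
    2 * (p ^ 2 + q ^ 2) ^ K ≤ 2 ^ K * ((p ^ 2) ^ K + (q ^ 2) ^ K) + ((p - q) ^ 2) ^ K := by
  rcases (hq.trans hqp).eq_or_lt with rfl | hp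
  · obtain rfl : q = 0 := le_antisymm hqp hq
    simp [Real.zero_rpow hK.1.ne']
  have hw : 0 < p ^ 2 + q ^ 2 := by positivity
  set w := p ^ 2 + q ^ 2 with hwdef
  have h := two_le_one_add_rpow_add_one_sub_rpow_add_rpow (B := (p ^ 2 - q ^ 2) / w)
    (c := (p - q) ^ 2 / w) hK (div_nonneg (by nlinarith) hw.le)
    ((div_le_one hw).2 (by nlinarith)) (by positivity) ((div_le_one hw).2 (by nlinarith))
    (by field_simp; rw [hwdef]; ring)
  have e1 : 1 + (p ^ 2 - q ^ 2) / w = 2 * p ^ 2 / w := by field_simp; rw [hwdef]; ring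
  have e2 : 1 - (p ^ 2 - q ^ 2) / w = 2 * q ^ 2 / w := by field_simp; rw [hwdef]; ring
  rw [e1, e2, Real.div_rpow (by positivity) hw.le, Real.div_rpow (by positivity) hw.le,
    Real.div_rpow (by positivity) hw.le, ← add_div, ← add_div,
    le_div_iff₀ (Real.rpow_pos_of_pos hw K), Real.mul_rpow (by norm_num) (by positivity),
    Real.mul_rpow (by norm_num) (by positivity)] at h
  linarith

lemma rpow_add_rpow_le_two_rpow_mul {K a b : ℝ} (hK : K ∈ Set.Ioc (0 : ℝ) 1)
    (ha : 0 ≤ a) (hb : 0 ≤ b) : a ^ K + b ^ K ≤ 2 ^ (1 - K) * (a + b) ^ K := by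
  have h := (Real.concaveOn_rpow hK.1.le hK.2).2 (Set.mem_Ici.2 ha) (Set.mem_Ici.2 hb)
    (show (0 : ℝ) ≤ 1 / 2 by norm_num) (show (0 : ℝ) ≤ 1 / 2 by norm_num) (by norm_num)
  simp only [smul_eq_mul] at h
  rw [← mul_add, ← mul_add, Real.mul_rpow (by norm_num) (by positivity), one_div,
    Real.inv_rpow (by norm_num), ← Real.rpow_neg (by norm_num)] at h
  rw [sub_eq_add_neg, Real.rpow_add (by norm_num), Real.rpow_one]
  linarith

lemma rpow_sub_rpow_le_sub_rpow {H s t : ℝ} (hH : H ∈ Set.Ioo (0 : ℝ) 1)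
    (hs : 0 ≤ s) (hst : s ≤ t) : t ^ H - s ^ H ≤ (t - s) ^ H := by
  have h := Real.rpow_add_le_add_rpow (sub_nonneg.2 hst) hs hH.1.le hH.2.le
  rw [sub_add_cancel] at h
  linarith


/-- Bounds on the increment variance of the bifractional Brownian
motion with parameters `H ∈ (0,1)` and `K ∈ (0,1]`. -/
theorem bifractional_increment_variance_bounds
    (H K : ℝ) (hH : H ∈ Set.Ioo (0 : ℝ) 1) (hK : K ∈ Set.Ioc (0 : ℝ) 1)
    (s t : ℝ) (hs : 0 ≤ s) (hst : s ≤ t) :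
    (2 : ℝ) ^ (-K) * (t - s) ^ (2 * H * K) ≤
      t ^ (2 * H * K) + s ^ (2 * H * K) -
        2 ^ (1 - K) * ((t ^ (2 * H) + s ^ (2 * H)) ^ K - (t - s) ^ (2 * H * K)) ∧
    t ^ (2 * H * K) + s ^ (2 * H * K) -
        2 ^ (1 - K) * ((t ^ (2 * H) + s ^ (2 * H)) ^ K - (t - s) ^ (2 * H * K)) ≤
      (2 : ℝ) ^ (1 - K) * (t - s) ^ (2 * H * K) := by
  have ht : 0 ≤ t := hs.trans hst
  have hd : 0 ≤ t - s := sub_nonneg.2 hst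
  rw [Real.rpow_mul ht, Real.rpow_mul hs, Real.rpow_mul hd]
  have h2 : (2 : ℝ) ^ (1 - K) = 2 * 2 ^ (-K) := by
    rw [sub_eq_add_neg, Real.rpow_add (by norm_num), Real.rpow_one]
  constructor
  · have hsq : ∀ x : ℝ, 0 ≤ x → x ^ (2 * H) = (x ^ H) ^ 2 := fun x hx => by
      rw [mul_comm, Real.rpow_mul hx, Real.rpow_two]
    have hqp : s ^ H ≤ t ^ H := Real.rpow_le_rpow hs hst hH.1.le
    have hmain := two_mul_sq_add_sq_rpow_le hK (Real.rpow_nonneg hs H) hqp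
    have hmono : ((t ^ H - s ^ H) ^ 2) ^ K ≤ (((t - s) ^ H) ^ 2) ^ K :=
      Real.rpow_le_rpow (sq_nonneg _) (pow_le_pow_left₀ (sub_nonneg.2 hqp)
        (rpow_sub_rpow_le_sub_rpow hH hs hst) 2) hK.1.le
    have hinv : (2 : ℝ) ^ (-K) * 2 ^ K = 1 := by
      rw [← Real.rpow_add (by norm_num)]; simp
    rw [hsq t ht, hsq s hs, hsq (t - s) hd, h2]
    have h := mul_le_mul_of_nonneg_left (hmain.trans (add_le_add_right hmono _))
      (Real.rpow_nonneg (show (0 : ℝ) ≤ 2 by norm_num) (-K))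
    rw [mul_add, ← mul_assoc (2 ^ (-K) : ℝ) (2 ^ K), hinv] at h
    linarith
  · have h := rpow_add_rpow_le_two_rpow_mul hK (Real.rpow_nonneg ht (2 * H))
      (Real.rpow_nonneg hs (2 * H))
    linarith
end

section
/- Let H ∈ (0,1), K ∈ (0,1], and let B = {B_t, t ∈ [0,1]} be a process on a probability space (Ω, F, P) such that for all s, t ∈ [0,1] the increment B_t - B_s is a centered Gaussian random variable with variance t^{2HK} + s^{2HK} - 2^{1-K}((t^{2H} + s^{2H})^K - |t - s|^{2HK}) (the increment variance of the bifractional Brownian motion). Then for every δ with 0 < δ < HK the process B admits a modification whose sample paths are Hölder continuous of order δ on [0,1]. -/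
open MeasureTheory ProbabilityTheory

open Filter Topology NNReal ENNReal

/-- The largest dyadic number `k / 2 ^ m` with `k : ℕ` that is at most `t` (for `0 ≤ t`). -/
noncomputable def dyadicFloor (m : ℕ) (t : ℝ) : ℝ := (⌊2 ^ m * t⌋₊ : ℝ) / 2 ^ m

lemma dyadicFloor_le (m : ℕ) {t : ℝ} (ht : 0 ≤ t) : dyadicFloor m t ≤ t := by
  rw [dyadicFloor, div_le_iff₀' (by positivity)]
  exact Nat.floor_le (by positivity)

lemma sub_dyadicFloor_le (m : ℕ) (t : ℝ) : t - dyadicFloor m t ≤ (2⁻¹ : ℝ) ^ m := by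
  have h := (Nat.lt_floor_add_one (2 ^ m * t)).le
  rw [dyadicFloor, inv_pow, sub_le_iff_le_add, ← one_div, ← add_div, le_div_iff₀' (by positivity)]
  linarith

lemma dyadicFloor_mem_Icc (m : ℕ) {t : ℝ} (ht : t ∈ Set.Icc (0 : ℝ) 1) :
    dyadicFloor m t ∈ Set.Icc (0 : ℝ) 1 :=
  ⟨by unfold dyadicFloor; positivity, (dyadicFloor_le m ht.1).trans ht.2⟩

lemma floor_two_pow_mul_le (m : ℕ) {t : ℝ} (ht : t ≤ 1) : ⌊2 ^ m * t⌋₊ ≤ 2 ^ m := by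
  refine Nat.floor_le_of_le ?_
  push_cast
  exact mul_le_of_le_one_right (by positivity) ht

/-- The increments of `f` between neighbouring points of the `m`-th dyadic subdivision of `[0,1]`
are at most `A * r ^ m`. -/
def DyadicIncrementBound (f : ℝ → ℝ) (A r : ℝ) : Prop :=
  ∀ m k : ℕ, k < 2 ^ m → |f (((k + 1 : ℕ) : ℝ) / 2 ^ m) - f ((k : ℝ) / 2 ^ m)| ≤ A * r ^ m

namespace DyadicIncrementBound

variable {f : ℝ → ℝ} {A r : ℝ}

lemma dist_le_of_le_succ (h : DyadicIncrementBound f A r) (hA : 0 ≤ A) (hr : 0 ≤ r) {m k l : ℕ}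
    (hkl : k ≤ l) (hlk : l ≤ k + 1) (hl : l ≤ 2 ^ m) :
    dist (f ((k : ℝ) / 2 ^ m)) (f ((l : ℝ) / 2 ^ m)) ≤ A * r ^ m := by
  obtain rfl | rfl : l = k ∨ l = k + 1 := by omega
  · simp only [dist_self]
    positivity
  · rw [dist_comm, Real.dist_eq]
    exact h m k hl

lemma dist_dyadicFloor_succ_le (h : DyadicIncrementBound f A r) (hA : 0 ≤ A) (hr : 0 ≤ r)
    (hr1 : r ≤ 1) {t : ℝ} (ht : t ∈ Set.Icc (0 : ℝ) 1) (m : ℕ) :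
    dist (f (dyadicFloor m t)) (f (dyadicFloor (m + 1) t)) ≤ A * r ^ m := by
  have ht0 := ht.1
  have h2 : dyadicFloor m t = ((2 * ⌊2 ^ m * t⌋₊ : ℕ) : ℝ) / 2 ^ (m + 1) := by
    rw [dyadicFloor]
    push_cast
    field_simp
    ring
  have hlow : 2 * ⌊2 ^ m * t⌋₊ ≤ ⌊2 ^ (m + 1) * t⌋₊ := by
    refine Nat.le_floor ?_
    have := Nat.floor_le (a := 2 ^ m * t) (by positivity)
    push_cast
    rw [pow_succ]
    linarith
  have hup : ⌊2 ^ (m + 1) * t⌋₊ ≤ 2 * ⌊2 ^ m * t⌋₊ + 1 := by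
    refine Nat.lt_succ_iff.mp ((Nat.floor_lt (by positivity)).mpr ?_)
    have := Nat.lt_floor_add_one (2 ^ m * t)
    push_cast
    rw [pow_succ]
    linarith
  rw [h2]
  refine (h.dist_le_of_le_succ hA hr hlow hup (floor_two_pow_mul_le _ ht.2)).trans ?_
  exact mul_le_mul_of_nonneg_left (pow_le_pow_of_le_one hr hr1 m.le_succ) hA

lemma dist_dyadicFloor_le (h : DyadicIncrementBound f A r) (hA : 0 ≤ A) (hr : 0 ≤ r) {s t : ℝ}
    (hs : 0 ≤ s) (hst : s ≤ t) (ht : t ≤ 1) {m : ℕ} (hm : t - s ≤ (2⁻¹ : ℝ) ^ m) :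
    dist (f (dyadicFloor m s)) (f (dyadicFloor m t)) ≤ A * r ^ m := by
  refine h.dist_le_of_le_succ hA hr (Nat.floor_mono (by gcongr)) ?_ (floor_two_pow_mul_le _ ht)
  rw [← Nat.floor_add_one (by positivity)]
  refine Nat.floor_mono ?_
  rw [inv_pow, ← one_div, le_div_iff₀' (by positivity)] at hm
  linarith

lemma tendsto_limUnder (h : DyadicIncrementBound f A r) (hA : 0 ≤ A) (hr : 0 ≤ r) (hr1 : r < 1)
    {t : ℝ} (ht : t ∈ Set.Icc (0 : ℝ) 1) :
    Tendsto (fun m => f (dyadicFloor m t)) atTop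
      (𝓝 (limUnder atTop fun m => f (dyadicFloor m t))) :=
  (cauchySeq_of_le_geometric r A hr1
    (h.dist_dyadicFloor_succ_le hA hr hr1.le ht)).tendsto_limUnder

lemma dist_limUnder_le (h : DyadicIncrementBound f A r) (hA : 0 ≤ A) (hr : 0 ≤ r) (hr1 : r < 1)
    {t : ℝ} (ht : t ∈ Set.Icc (0 : ℝ) 1) (m : ℕ) :
    dist (f (dyadicFloor m t)) (limUnder atTop fun m => f (dyadicFloor m t))
      ≤ A * r ^ m / (1 - r) :=
  dist_le_of_le_geometric_of_tendsto r A hr1 (h.dist_dyadicFloor_succ_le hA hr hr1.le ht)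
    (h.tendsto_limUnder hA hr hr1 ht) m

end DyadicIncrementBound

lemma two_rpow_neg_pow (δ : ℝ) (m : ℕ) : ((2 : ℝ) ^ (-δ)) ^ m = ((2⁻¹ : ℝ) ^ m) ^ δ := by
  rw [← Real.rpow_natCast ((2 : ℝ) ^ (-δ)), ← Real.rpow_natCast (2⁻¹ : ℝ), ← Real.rpow_mul (by simp),
    ← Real.rpow_mul (by simp), Real.inv_rpow (by simp), ← Real.rpow_neg (by simp)]
  ring_nf

/-- Geometrically decaying dyadic increments give a Hölder continuous limit along dyadics. -/
lemma DyadicIncrementBound.holderOnWith_limUnder {f : ℝ → ℝ} {A δ : ℝ} (hA : 0 ≤ A) (hδ : 0 < δ)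
    (h : DyadicIncrementBound f A ((2 : ℝ) ^ (-δ))) :
    ∃ C : ℝ≥0, HolderOnWith C ⟨δ, hδ.le⟩
      (fun t => limUnder atTop fun m => f (dyadicFloor m t)) (Set.Icc (0 : ℝ) 1) := by
  have hr0 : (0 : ℝ) < 2 ^ (-δ) := by positivity
  have hr1 : (2 : ℝ) ^ (-δ) < 1 := Real.rpow_lt_one_of_one_lt_of_neg (by norm_num) (by linarith)
  set r : ℝ := 2 ^ (-δ) with hr
  set g : ℝ → ℝ := fun t => limUnder atTop fun m => f (dyadicFloor m t) with hg
  have h1r : 0 < 1 - r := by linarith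
  have hC : 0 ≤ A * (1 + 2 / (1 - r)) / r := by positivity
  have key : ∀ s t : ℝ, 0 ≤ s → s < t → t ≤ 1 →
      dist (g s) (g t) ≤ A * (1 + 2 / (1 - r)) / r * dist s t ^ δ := by
    intro s t hs hst ht
    obtain ⟨m, hm1, hm2⟩ := exists_nat_pow_near_of_lt_one (x := t - s) (y := (2⁻¹ : ℝ))
      (by linarith) (by linarith) (by norm_num) (by norm_num)
    have hs' := h.dist_limUnder_le hA hr0.le hr1 (t := s) ⟨hs, by linarith⟩ m
    have ht' := h.dist_limUnder_le hA hr0.le hr1 (t := t) ⟨by linarith, ht⟩ m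
    have hst' := h.dist_dyadicFloor_le hA hr0.le hs hst.le ht hm2
    have hdist : dist s t = t - s := by rw [dist_comm, Real.dist_eq, abs_of_pos (by linarith)]
    have hpow : r ^ (m + 1) ≤ dist s t ^ δ := by
      rw [hr, two_rpow_neg_pow, hdist]
      exact Real.rpow_le_rpow (by positivity) hm1.le hδ.le
    rw [dist_comm] at hs'
    calc dist (g s) (g t) ≤ A * r ^ m / (1 - r) + A * r ^ m + A * r ^ m / (1 - r) :=
          (dist_triangle4 _ _ _ _).trans (add_le_add (add_le_add hs' hst') ht')
      _ = A * (1 + 2 / (1 - r)) / r * r ^ (m + 1) := by field_simp; ring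
      _ ≤ _ := by gcongr
  have key' : ∀ s ∈ Set.Icc (0 : ℝ) 1, ∀ t ∈ Set.Icc (0 : ℝ) 1,
      dist (g s) (g t) ≤ A * (1 + 2 / (1 - r)) / r * dist s t ^ δ := by
    intro s hs t ht
    rcases lt_trichotomy s t with hst | rfl | hst
    · exact key s t hs.1 hst ht.2
    · simp only [dist_self]
      positivity
    · rw [dist_comm, dist_comm s]
      exact key t s ht.1 hst hs.2
  refine ⟨⟨_, hC⟩, fun s hs t ht => ?_⟩
  have hk := ENNReal.ofReal_le_ofReal (key' s hs t ht)
  rw [ENNReal.ofReal_mul hC, ← ENNReal.ofReal_rpow_of_nonneg dist_nonneg hδ.le, ← edist_dist,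
    ← edist_dist, ENNReal.ofReal_eq_coe_nnreal hC] at hk
  exact hk

section Kolmogorov

variable {Ω : Type*} [MeasurableSpace Ω] {μ : Measure Ω}

/-- Nonnegative functions whose integrals are dominated by a geometric sequence are almost
everywhere summable. -/
lemma ae_tsum_ne_top_of_lintegral_le_geometric {F : ℕ → Ω → ℝ≥0∞} {M θ : ℝ}
    (hF : ∀ m, AEMeasurable (F m) μ) (hθ0 : 0 ≤ θ) (hθ1 : θ < 1)
    (h : ∀ m, ∫⁻ ω, F m ω ∂μ ≤ ENNReal.ofReal (M * θ ^ m)) :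
    ∀ᵐ ω ∂μ, ∑' m, F m ω ≠ ∞ := by
  have hint : ∫⁻ ω, ∑' m, F m ω ∂μ ≠ ∞ := by
    rw [lintegral_tsum hF]
    refine ne_top_of_le_ne_top ?_ (ENNReal.tsum_le_tsum h)
    exact ((summable_geometric_of_lt_one hθ0 hθ1).mul_left M).tsum_ofReal_ne_top
  exact (ae_lt_top' (AEMeasurable.tsum hF) hint).mono fun _ hω => hω.ne

variable {B : ℝ → Ω → ℝ} {M q : ℝ} {p : ℕ}

/-- Under a Kolmogorov moment bound, almost all paths have dyadic increments bounded by the powers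
of `2 ^ (-δ)`. -/
lemma ae_exists_dyadicIncrementBound {δ : ℝ} (hp : p ≠ 0) (hq : 1 + p * δ < q)
    (hmeas : ∀ s ∈ Set.Icc (0 : ℝ) 1, ∀ t ∈ Set.Icc (0 : ℝ) 1,
      AEMeasurable (fun ω => B t ω - B s ω) μ)
    (hmom : ∀ s ∈ Set.Icc (0 : ℝ) 1, ∀ t ∈ Set.Icc (0 : ℝ) 1,
      ∫⁻ ω, ‖B t ω - B s ω‖ₑ ^ p ∂μ ≤ ENNReal.ofReal (M * |t - s| ^ q)) :
    ∀ᵐ ω ∂μ, ∃ A : ℝ, 0 ≤ A ∧ DyadicIncrementBound (fun t => B t ω) A ((2 : ℝ) ^ (-δ)) := by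
  set ρ : ℝ := 2 ^ δ with hρ
  have hρ0 : 0 < ρ := by positivity
  have hmem : ∀ {m k : ℕ}, k ≤ 2 ^ m → (k : ℝ) / 2 ^ m ∈ Set.Icc (0 : ℝ) 1 := fun {m k} hk =>
    ⟨by positivity, (div_le_one (by positivity)).mpr (by exact_mod_cast hk)⟩
  set θ : ℝ := 2 * ρ ^ p * 2 ^ (-q) with hθ
  have hθ0 : 0 ≤ θ := by positivity
  have hθ1 : θ < 1 := by
    have : θ = 2 ^ (1 + p * δ - q) := by
      rw [hθ, hρ, ← Real.rpow_natCast, ← Real.rpow_mul (by simp), sub_eq_add_neg,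
        Real.rpow_add (by simp), Real.rpow_add (by simp), Real.rpow_one, mul_comm δ]
    rw [this]
    exact Real.rpow_lt_one_of_one_lt_of_neg (by norm_num) (by linarith)
  set F : ℕ → Ω → ℝ≥0∞ := fun m ω => ∑ k ∈ Finset.range (2 ^ m),
    ENNReal.ofReal ((ρ ^ m) ^ p) * ‖B (((k + 1 : ℕ) : ℝ) / 2 ^ m) ω - B ((k : ℝ) / 2 ^ m) ω‖ₑ ^ p
    with hF
  have hterm : ∀ m, ∀ k ∈ Finset.range (2 ^ m), AEMeasurable (fun ω => ENNReal.ofReal ((ρ ^ m) ^ p) *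
      ‖B (((k + 1 : ℕ) : ℝ) / 2 ^ m) ω - B ((k : ℝ) / 2 ^ m) ω‖ₑ ^ p) μ := by
    intro m k hk
    rw [Finset.mem_range] at hk
    exact ((hmeas _ (hmem hk.le) _ (hmem hk)).enorm.pow_const p).const_mul _
  have hFmeas : ∀ m, AEMeasurable (F m) μ := fun m =>
    Finset.aemeasurable_fun_sum _ (hterm m)
  have hint : ∀ m, ∫⁻ ω, F m ω ∂μ ≤ ENNReal.ofReal (M * θ ^ m) := by
    intro m
    rw [lintegral_finsetSum' _ (hterm m)]
    calc _ ≤ ∑ k ∈ Finset.range (2 ^ m),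
          ENNReal.ofReal ((ρ ^ m) ^ p) * ENNReal.ofReal (M * ((2 : ℝ) ^ (-q)) ^ m) := by
          refine Finset.sum_le_sum fun k hk => ?_
          rw [Finset.mem_range] at hk
          rw [lintegral_const_mul' _ _ ENNReal.ofReal_ne_top]
          have hstep : ((k + 1 : ℕ) : ℝ) / 2 ^ m - (k : ℝ) / 2 ^ m = 2⁻¹ ^ m := by
            rw [div_sub_div_same, Nat.cast_add_one, add_sub_cancel_left, one_div, inv_pow]
          have hk1 := hmom _ (hmem hk.le) _ (hmem (k := k + 1) hk)
          rw [hstep, abs_of_pos (by positivity), ← two_rpow_neg_pow] at hk1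
          exact mul_le_mul_right hk1 _
      _ = ENNReal.ofReal (M * θ ^ m) := by
          rw [Finset.sum_const, Finset.card_range, nsmul_eq_mul,
            ← ENNReal.ofReal_mul (by positivity), ← ENNReal.ofReal_natCast,
            ← ENNReal.ofReal_mul (by positivity), hθ]
          congr 1
          push_cast
          ring
  filter_upwards [ae_tsum_ne_top_of_lintegral_le_geometric hFmeas hθ0 hθ1 hint] with ω hω
  refine ⟨1 + (∑' m, F m ω).toReal, by positivity, fun m k hk => ?_⟩
  set Δ : ℝ := B (((k + 1 : ℕ) : ℝ) / 2 ^ m) ω - B ((k : ℝ) / 2 ^ m) ω with hΔ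
  have hle : ENNReal.ofReal ((ρ ^ m * |Δ|) ^ p) ≤ ∑' m, F m ω := by
    refine le_trans ?_ (ENNReal.le_tsum m)
    refine le_trans (le_of_eq ?_) (Finset.single_le_sum
      (f := fun k : ℕ => ENNReal.ofReal ((ρ ^ m) ^ p) *
        ‖B (((k + 1 : ℕ) : ℝ) / 2 ^ m) ω - B ((k : ℝ) / 2 ^ m) ω‖ₑ ^ p)
      (fun _ _ => zero_le) (Finset.mem_range.mpr hk))
    rw [mul_pow, ENNReal.ofReal_mul (by positivity), ENNReal.ofReal_pow (abs_nonneg Δ),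
      ← Real.norm_eq_abs, ofReal_norm]
  have hle' : (ρ ^ m * |Δ|) ^ p ≤ (1 + (∑' m, F m ω).toReal) ^ p := by
    have h1 := (ENNReal.ofReal_le_iff_le_toReal hω).mp hle
    have h2 : 1 + (∑' m, F m ω).toReal ≤ (1 + (∑' m, F m ω).toReal) ^ p :=
      le_self_pow₀ (le_add_of_nonneg_right ENNReal.toReal_nonneg) hp
    linarith
  have hfin : ρ ^ m * |Δ| ≤ 1 + (∑' m, F m ω).toReal :=
    (pow_le_pow_iff_left₀ (by positivity) (by positivity) hp).mp hle'
  rw [Real.rpow_neg (by simp), ← hρ, inv_pow, ← div_eq_mul_inv, le_div_iff₀' (by positivity)]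
  exact hfin

/-- Under a Kolmogorov moment bound, the process at time `t` is almost surely the limit of its
values at the dyadic approximations of `t`. -/
lemma ae_tendsto_dyadicFloor (hp : p ≠ 0) (hM : 0 ≤ M) (hq : 0 < q)
    (hmeas : ∀ s ∈ Set.Icc (0 : ℝ) 1, ∀ t ∈ Set.Icc (0 : ℝ) 1,
      AEMeasurable (fun ω => B t ω - B s ω) μ)
    (hmom : ∀ s ∈ Set.Icc (0 : ℝ) 1, ∀ t ∈ Set.Icc (0 : ℝ) 1,
      ∫⁻ ω, ‖B t ω - B s ω‖ₑ ^ p ∂μ ≤ ENNReal.ofReal (M * |t - s| ^ q))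
    {t : ℝ} (ht : t ∈ Set.Icc (0 : ℝ) 1) :
    ∀ᵐ ω ∂μ, Tendsto (fun m => B (dyadicFloor m t) ω) atTop (𝓝 (B t ω)) := by
  have hint : ∀ m, ∫⁻ ω, ‖B (dyadicFloor m t) ω - B t ω‖ₑ ^ p ∂μ
      ≤ ENNReal.ofReal (M * ((2 : ℝ) ^ (-q)) ^ m) := by
    intro m
    refine (hmom t ht _ (dyadicFloor_mem_Icc m ht)).trans (ENNReal.ofReal_le_ofReal ?_)
    rw [two_rpow_neg_pow, abs_sub_comm, abs_of_nonneg (sub_nonneg.mpr (dyadicFloor_le m ht.1))]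
    gcongr
    · exact sub_nonneg.mpr (dyadicFloor_le m ht.1)
    · exact sub_dyadicFloor_le m t
  filter_upwards [ae_tsum_ne_top_of_lintegral_le_geometric
    (fun m => (hmeas t ht _ (dyadicFloor_mem_Icc m ht)).enorm.pow_const p) (by positivity)
    (Real.rpow_lt_one_of_one_lt_of_neg (by norm_num) (by linarith)) hint] with ω hω
  have h0 := ENNReal.tendsto_atTop_zero_of_tsum_ne_top hω
  have h1 := h0.ennrpow_const ((p : ℝ)⁻¹)
  simp only [ENNReal.pow_rpow_inv_natCast hp,
    ENNReal.zero_rpow_of_pos (inv_pos.mpr (Nat.cast_pos.mpr (Nat.pos_of_ne_zero hp)))] at h1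
  rw [tendsto_iff_edist_tendsto_0]
  simpa only [edist_eq_enorm_sub] using h1

/-- **Kolmogorov–Chentsov theorem** on `[0,1]`: a real process whose increments satisfy
`E |B t - B s| ^ p ≤ M |t - s| ^ q` has a `δ`-Hölder modification whenever `1 + p δ < q`. -/
theorem exists_holder_modification_of_moment_le {δ : ℝ} (hδ : 0 < δ) (hp : p ≠ 0) (hM : 0 ≤ M)
    (hq : 1 + p * δ < q)
    (hmeas : ∀ s ∈ Set.Icc (0 : ℝ) 1, ∀ t ∈ Set.Icc (0 : ℝ) 1,
      AEMeasurable (fun ω => B t ω - B s ω) μ)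
    (hmom : ∀ s ∈ Set.Icc (0 : ℝ) 1, ∀ t ∈ Set.Icc (0 : ℝ) 1,
      ∫⁻ ω, ‖B t ω - B s ω‖ₑ ^ p ∂μ ≤ ENNReal.ofReal (M * |t - s| ^ q)) :
    ∃ B' : ℝ → Ω → ℝ, (∀ t ∈ Set.Icc (0 : ℝ) 1, B' t =ᵐ[μ] B t) ∧
      ∀ ω, ∃ C : ℝ≥0, HolderOnWith C ⟨δ, hδ.le⟩ (fun t => B' t ω) (Set.Icc (0 : ℝ) 1) := by
  classical
  have hq0 : 0 < q := lt_trans (by positivity) hq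
  refine ⟨fun t ω => if ∃ A : ℝ, 0 ≤ A ∧
      DyadicIncrementBound (fun t => B t ω) A ((2 : ℝ) ^ (-δ)) then
      limUnder atTop fun m => B (dyadicFloor m t) ω else 0, fun t ht => ?_, fun ω => ?_⟩
  · filter_upwards [ae_exists_dyadicIncrementBound hp hq hmeas hmom,
      ae_tendsto_dyadicFloor hp hM hq0 hmeas hmom ht] with ω h1 h2
    rw [if_pos h1]
    exact h2.limUnder_eq
  · by_cases h : ∃ A : ℝ, 0 ≤ A ∧ DyadicIncrementBound (fun t => B t ω) A ((2 : ℝ) ^ (-δ))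
    · simp only [if_pos h]
      obtain ⟨A, hA, hAB⟩ := h
      exact hAB.holderOnWith_limUnder hA hδ
    · simp only [if_neg h]
      exact ⟨0, fun s _ t _ => by simp⟩

end Kolmogorov

/-- Scaling of the absolute moments of a centered Gaussian law. -/
lemma lintegral_enorm_pow_gaussianReal (v : ℝ≥0) (p : ℕ) :
    ∫⁻ x, ‖x‖ₑ ^ p ∂gaussianReal 0 v =
      ENNReal.ofReal (√v ^ p) * ∫⁻ x, ‖x‖ₑ ^ p ∂gaussianReal 0 1 := by
  have hmap : gaussianReal 0 v = (gaussianReal 0 1).map (√v * ·) := by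
    rw [gaussianReal_map_const_mul]
    congr 1
    · simp
    · ext
      simp
  rw [hmap, lintegral_map (by fun_prop) (by fun_prop),
    ← lintegral_const_mul' _ _ ENNReal.ofReal_ne_top]
  refine lintegral_congr fun x => ?_
  rw [enorm_mul, mul_pow, Real.enorm_eq_ofReal (Real.sqrt_nonneg _),
    ENNReal.ofReal_pow (Real.sqrt_nonneg _)]

lemma lintegral_enorm_pow_gaussianReal_ne_top (v : ℝ≥0) (p : ℕ) :
    ∫⁻ x, ‖x‖ₑ ^ p ∂gaussianReal 0 v ≠ ∞ := by
  rcases eq_or_ne p 0 with rfl | hp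
  · simp
  · have h := (memLp_id_gaussianReal (μ := 0) (v := v) p).eLpNorm_lt_top
    have := lintegral_rpow_enorm_lt_top_of_eLpNorm_lt_top (p := ((p : ℝ≥0) : ℝ≥0∞))
      (by simpa using hp) (by simp) h
    simpa using this.ne

/-- The increment variance of the bifractional Brownian motion is at most
`2 ^ (1 - K) * |t - s| ^ (2 * H * K)`. -/
lemma bifractional_variance_le {H K s t : ℝ} (hK : K ∈ Set.Ioc (0 : ℝ) 1)
    (hs : 0 ≤ s) (ht : 0 ≤ t) :
    t ^ (2 * H * K) + s ^ (2 * H * K) -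
        2 ^ (1 - K) * ((t ^ (2 * H) + s ^ (2 * H)) ^ K - |t - s| ^ (2 * H * K)) ≤
      2 ^ (1 - K) * |t - s| ^ (2 * H * K) := by
  have ha : 0 ≤ t ^ (2 * H) := by positivity
  have hb : 0 ≤ s ^ (2 * H) := by positivity
  have hconc := (Real.concaveOn_rpow hK.1.le hK.2).2 (Set.mem_Ici.mpr ha) (Set.mem_Ici.mpr hb)
    (by norm_num : (0 : ℝ) ≤ 1 / 2) (by norm_num : (0 : ℝ) ≤ 1 / 2) (by norm_num)
  simp only [smul_eq_mul] at hconc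
  rw [← mul_add, ← mul_add, Real.mul_rpow (by norm_num) (by positivity),
    ← Real.rpow_mul ht, ← Real.rpow_mul hs, one_div, Real.inv_rpow (by norm_num)] at hconc
  have h2 : (2 : ℝ) ^ (1 - K) = 2 * (2 ^ K)⁻¹ := by
    rw [Real.rpow_sub (by norm_num), Real.rpow_one, div_eq_mul_inv]
  rw [h2]
  linarith



/-- A process on `[0,1]` whose increments are centered Gaussian with the
increment variance of the bifractional Brownian motion with parameters `H ∈ (0,1)`,
`K ∈ (0,1]` admits a modification with `δ`-Hölder continuous sample paths on `[0,1]`,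
for every `0 < δ < HK`. -/
theorem holder_modification_of_bifractional_increments
    {Ω : Type*} [MeasureSpace Ω] [IsProbabilityMeasure (ℙ : Measure Ω)]
    (H K : ℝ) (hH : H ∈ Set.Ioo (0 : ℝ) 1) (hK : K ∈ Set.Ioc (0 : ℝ) 1)
    (B : ℝ → Ω → ℝ)
    (hB : ∀ s ∈ Set.Icc (0 : ℝ) 1, ∀ t ∈ Set.Icc (0 : ℝ) 1,
      Measure.map (fun ω => B t ω - B s ω) ℙ =
        gaussianReal 0 (Real.toNNReal
          (t ^ (2 * H * K) + s ^ (2 * H * K) -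
            2 ^ (1 - K) * ((t ^ (2 * H) + s ^ (2 * H)) ^ K - |t - s| ^ (2 * H * K)))))
    (δ : ℝ) (hδ0 : 0 < δ) (hδHK : δ < H * K) :
    ∃ B' : ℝ → Ω → ℝ,
      (∀ t ∈ Set.Icc (0 : ℝ) 1, ℙ {ω | B' t ω = B t ω} = 1) ∧
      (∀ ω : Ω, ∃ C : NNReal,
        HolderOnWith C ⟨δ, hδ0.le⟩ (fun t => B' t ω) (Set.Icc (0 : ℝ) 1)) := by
  obtain ⟨p, hp⟩ := exists_nat_gt (1 / (H * K - δ))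
  have hgap : 0 < H * K - δ := sub_pos.mpr hδHK
  have hp0 : p ≠ 0 := by
    rintro rfl
    exact absurd hp (not_lt.mpr (by simpa using hgap.le))
  have hq : 1 + p * δ < p * (H * K) := by
    rw [div_lt_iff₀ hgap] at hp
    linarith
  set c : ℝ := √(2 ^ (1 - K)) with hc
  set m : ℝ≥0∞ := ∫⁻ x, ‖x‖ₑ ^ p ∂gaussianReal 0 1 with hm
  have hmeas : ∀ s ∈ Set.Icc (0 : ℝ) 1, ∀ t ∈ Set.Icc (0 : ℝ) 1,
      AEMeasurable (fun ω => B t ω - B s ω) ℙ := fun s hs t ht =>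
    aemeasurable_of_map_neZero (by rw [hB s hs t ht]; infer_instance)
  obtain ⟨B', hB', hholder⟩ := exists_holder_modification_of_moment_le (μ := ℙ) (B := B)
    (M := c ^ p * m.toReal) hδ0 hp0 (by positivity) hq hmeas fun s hs t ht => by
      rw [← lintegral_map' (f := fun x : ℝ => ‖x‖ₑ ^ p) (by fun_prop) (hmeas s hs t ht),
        hB s hs t ht, lintegral_enorm_pow_gaussianReal,
        ← ENNReal.ofReal_toReal (lintegral_enorm_pow_gaussianReal_ne_top 1 p),
        ← ENNReal.ofReal_mul (by positivity)]
      refine ENNReal.ofReal_le_ofReal ?_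
      rw [mul_right_comm (c ^ p)]
      refine mul_le_mul_of_nonneg_right ?_ ENNReal.toReal_nonneg
      rw [mul_comm (p : ℝ), Real.rpow_mul_natCast (abs_nonneg _), ← mul_pow]
      refine pow_le_pow_left₀ (Real.sqrt_nonneg _) ?_ p
      have hsq : |t - s| ^ (H * K) = √(|t - s| ^ (2 * H * K)) := by
        rw [Real.sqrt_eq_rpow, ← Real.rpow_mul (abs_nonneg _)]
        ring_nf
      rw [hsq, hc, ← Real.sqrt_mul (by positivity)]
      refine Real.sqrt_le_sqrt ?_
      rw [Real.coe_toNNReal']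
      exact max_le (bifractional_variance_le hK hs.1 ht.1) (by positivity)
  refine ⟨B', fun t ht => ?_, hholder⟩
  have hae : {ω | B' t ω = B t ω} =ᵐ[ℙ] Set.univ := eventuallyEq_univ.mpr (hB' t ht)
  rw [measure_congr hae, measure_univ]
end
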